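/- Let k ≥ 1. Every null-homotopic chain map g : P• → P•[k] can be written as g = d(u) for some u ∈ Hom_A(P•,P•[k−1]) whose component in degree k−1 vanishes, i.e. there exist maps u^{(l)} : P_l → P_{l−k+1} with u^{(k−1)} = 0 and g^{(l)} = ∂_{l−k+1} ∘ u^{(l)} − (−1)^{k−1} u^{(l−1)} ∘ ∂_l for all l. -/

import Mathlib

/-!
STATEMENT 5 (part 2 of Lemma "basis of Ext" of the paper).

Setting: `K` algebraically closed, `A` a finite-dimensional `K`-algebra with a complete set
of pairwise orthogonal primitive idempotents `e 0, …, e (n-1)`; `P(i) = Ae_i` is encoded as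
`leftIdeal A (e i)`, `rad A` as the intersection of maximal left ideals, `rad_A(P,Q)` as the
homomorphisms with image in `(rad A)·Q`, and the properly standard module `Δ̄(i)` as
`P(i)/U(i)` with `U(i)` the sum of the images of all radical maps `P(j) → P(i)`, `j ≥ i`.

`P•` is a projective resolution of `Δ̄(i)` with `P_0 ≅ P(i)`, each `P_k` (`k ≥ 1`) a finite
direct sum of modules `P(j)` with `j ≥ i`, and all differentials radical maps (minimality).

Chain maps `g : P• → P•[k]` of degree `k = k' + 1 ≥ 1` are encoded by their components
`g m := g^{(m+k)} : P (k'+m+1) →ₗ[A] P m`, with the chain condition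
`g^{(l)} ∘ ∂_{l+1} = (-1)^k ∂_{l-k+1} ∘ g^{(l+1)}`; `g` is null-homotopic iff there are
`u^{(l)} : P_l → P_{l-k+1}` (encoded as `h m := u^{(m+k-1)}`) with
`g^{(l)} = ∂_{l-k+1} ∘ u^{(l)} - (-1)^(k-1) u^{(l-1)} ∘ ∂_l`.
-/

noncomputable section

def mulRightLin (A : Type*) [Ring A] (a : A) : A →ₗ[A] A where
  toFun x := x * a
  map_add' x y := add_mul x y a
  map_smul' r x := by simp [smul_eq_mul, mul_assoc]

def leftIdeal (A : Type*) [Ring A] (a : A) : Submodule A A := LinearMap.range (mulRightLin A a)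

def jacRad (A : Type*) [Ring A] : Ideal A := sInf {I : Ideal A | I.IsMaximal}

def radM (A : Type*) [Ring A] (M : Type*) [AddCommGroup M] [Module A M] : Submodule A M :=
  Submodule.span A {x | ∃ r ∈ jacRad A, ∃ m : M, x = r • m}

def IsRadHom (A : Type*) [Ring A] {M N : Type*} [AddCommGroup M] [Module A M]
    [AddCommGroup N] [Module A N] (f : M →ₗ[A] N) : Prop :=
  LinearMap.range f ≤ radM A N

def IsPrimitiveIdem (A : Type*) [Ring A] (x : A) : Prop :=
  IsIdempotentElem x ∧ x ≠ 0 ∧ ∀ y z : A, IsIdempotentElem y → IsIdempotentElem z →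
    y * z = 0 → z * y = 0 → x = y + z → y = 0 ∨ z = 0

/-- `U(i)`: the sum of the images of all radical maps `P(j) → P(i)` with `j ≥ i` -/
def properU (A : Type*) [Ring A] {n : ℕ} (e : Fin n → A) (i : Fin n) :
    Submodule A ↥(leftIdeal A (e i)) :=
  ⨆ (j : Fin n) (_ : i ≤ j) (φ : ↥(leftIdeal A (e j)) →ₗ[A] ↥(leftIdeal A (e i)))
    (_ : IsRadHom A φ), LinearMap.range φ

/-- the properly standard module `Δ̄(i) = P(i)/U(i)` -/
abbrev PStd (A : Type*) [Ring A] {n : ℕ} (e : Fin n → A) (i : Fin n) :=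
  ↥(leftIdeal A (e i)) ⧸ properU A e i

theorem IsRadHom.comp_left {A : Type*} [Ring A] {L M N : Type*} [AddCommGroup L] [Module A L]
    [AddCommGroup M] [Module A M] [AddCommGroup N] [Module A N] {f : L →ₗ[A] M}
    (hf : IsRadHom A f) (g : M →ₗ[A] N) : IsRadHom A (g ∘ₗ f) := by
  rintro _ ⟨x, rfl⟩
  have hle : radM A M ≤ (radM A N).comap g := by
    refine Submodule.span_le.2 ?_
    rintro _ ⟨r, hr, m, rfl⟩
    exact Submodule.subset_span ⟨r, hr, g m, map_smul g r m⟩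
  exact hle (hf ⟨x, rfl⟩)

theorem IsRadHom.comp_right {A : Type*} [Ring A] {L M N : Type*} [AddCommGroup L] [Module A L]
    [AddCommGroup M] [Module A M] [AddCommGroup N] [Module A N] {g : M →ₗ[A] N}
    (hg : IsRadHom A g) (f : L →ₗ[A] M) : IsRadHom A (g ∘ₗ f) :=
  (LinearMap.range_comp_le_range f g).trans hg

/-- A map from a finite direct sum of modules `P(j)`, `j ≥ i`, to `Δ̄(i)` that factors as a radical
map to a projective module followed by any map vanishes. -/
theorem comp_eq_zero_of_isRadHom {A : Type*} [Ring A] {n : ℕ} (e : Fin n → A) (i : Fin n)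
    {Q R : Type*} [AddCommGroup Q] [Module A Q] [AddCommGroup R] [Module A R]
    [Module.Projective A R] {m : ℕ} {js : Fin m → Fin n} (hjs : ∀ t, i ≤ js t)
    (E : Q ≃ₗ[A] ((t : Fin m) → ↥(leftIdeal A (e (js t)))))
    {φ : Q →ₗ[A] R} (hφ : IsRadHom A φ) (π : R →ₗ[A] PStd A e i) : π ∘ₗ φ = 0 := by
  obtain ⟨σ, rfl⟩ := Module.projective_lifting_property (properU A e i).mkQ π
    (Submodule.mkQ_surjective _)
  suffices H : ((properU A e i).mkQ ∘ₗ σ ∘ₗ φ) ∘ₗ E.symm.toLinearMap = 0 by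
    ext x
    simpa using congrArg (fun f => f (E x)) H
  refine LinearMap.pi_ext' fun t => LinearMap.ext fun x => ?_
  let ψ := (σ ∘ₗ φ) ∘ₗ E.symm.toLinearMap ∘ₗ
    LinearMap.single A (fun t => ↥(leftIdeal A (e (js t)))) t
  have hψ : IsRadHom A ψ := (hφ.comp_left σ).comp_right _
  have hle : LinearMap.range ψ ≤ properU A e i :=
    le_iSup_of_le (js t) <| le_iSup_of_le (hjs t) <| le_iSup_of_le ψ <| le_iSup_of_le hψ le_rfl
  exact (Submodule.Quotient.mk_eq_zero _).2 (hle ⟨x, rfl⟩)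

theorem exists_comp_eq_of_range_le {A : Type*} [Ring A] {Q M N : Type*} [AddCommGroup Q]
    [Module A Q] [AddCommGroup M] [Module A M] [AddCommGroup N] [Module A N]
    [Module.Projective A Q] (d : M →ₗ[A] N) (f : Q →ₗ[A] N)
    (hf : ∀ x, f x ∈ LinearMap.range d) : ∃ f' : Q →ₗ[A] M, d ∘ₗ f' = f := by
  obtain ⟨f', hf'⟩ := Module.projective_lifting_property d.rangeRestrict
    (f.codRestrict (LinearMap.range d) hf) d.surjective_rangeRestrict
  exact ⟨f', LinearMap.ext fun x => congrArg Subtype.val (LinearMap.congr_fun hf' x)⟩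

/-- A map in the lowest degree whose composite with the differential lifts extends to a map of
complexes of degree `k`, commuting with the differentials up to the sign `s`. -/
theorem exists_chain_map_extending {A : Type*} [Ring A] (P : ℕ → Type*)
    [∀ l, AddCommGroup (P l)] [∀ l, Module A (P l)] [∀ l, Module.Projective A (P l)]
    (d : ∀ l, P (l + 1) →ₗ[A] P l) (hex : ∀ l, Function.Exact (d (l + 1)) (d l))
    (k : ℕ) (s : ℤ) (f : P k →ₗ[A] P 0) (hf : ∀ x, f (d k x) ∈ LinearMap.range (d 0)) :
    ∃ z : ∀ m, P (k + m) →ₗ[A] P m, z 0 = f ∧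
      ∀ m, ((d m) ∘ₗ (z (m + 1)) : P (k + m + 1) →ₗ[A] P m) = s • ((z m) ∘ₗ (d (k + m))) := by
  let Z (m : ℕ) := {z : P (k + m) →ₗ[A] P m // ∀ x, z (d (k + m) x) ∈ LinearMap.range (d m)}
  have step (m : ℕ) (z : Z m) : ∃ z' : Z (m + 1),
      ((d m) ∘ₗ z'.1 : P (k + m + 1) →ₗ[A] P m) = s • (z.1 ∘ₗ (d (k + m))) := by
    obtain ⟨z', hz'⟩ := exists_comp_eq_of_range_le (d m) (s • (z.1 ∘ₗ d (k + m)))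
      fun x => zsmul_mem (z.2 x) s
    refine ⟨⟨z', fun x => (hex m _).1 ?_⟩, hz'⟩
    refine (LinearMap.congr_fun hz' (d (k + m + 1) x)).trans ?_
    simp [(hex (k + m)).apply_apply_eq_zero x]
  choose next hnext using step
  let z (m : ℕ) : Z m := Nat.rec ⟨f, hf⟩ next m
  exact ⟨fun m => (z m).1, rfl, fun m => hnext m (z m)⟩

theorem stmt5
    {K : Type u} [Field K] [IsAlgClosed K]
    {A : Type u} [Ring A] [Algebra K A] [FiniteDimensional K A]
    (n : ℕ) (e : Fin n → A)
    (hidem : ∀ i, IsPrimitiveIdem A (e i))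
    (horth : ∀ i j, i ≠ j → e i * e j = 0)
    (hcomplete : ∑ i, e i = 1)
    (i : Fin n)
    -- `P•` is a projective resolution of `Δ̄(i)` …
    (P : ℕ → Type u) [∀ l, AddCommGroup (P l)] [∀ l, Module A (P l)]
    (hproj : ∀ l, Module.Projective A (P l))
    (dP : ∀ l, P (l + 1) →ₗ[A] P l)
    (π : P 0 →ₗ[A] PStd A e i)
    (hπ : Function.Surjective π)
    (hex0 : Function.Exact (dP 0) π)
    (hex : ∀ l, Function.Exact (dP (l + 1)) (dP l))
    -- … with `P_0 ≅ P(i)` …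
    (hP0 : Nonempty (P 0 ≃ₗ[A] ↥(leftIdeal A (e i))))
    -- … each `P_k`, `k ≥ 1`, a finite direct sum of modules `P(j)` with `j ≥ i` …
    (hPk : ∀ k : ℕ, ∃ (m : ℕ) (js : Fin m → Fin n), (∀ t, i ≤ js t) ∧
      Nonempty (P (k + 1) ≃ₗ[A] ((t : Fin m) → ↥(leftIdeal A (e (js t))))))
    -- … and all differentials radical maps (minimal resolution)
    (hrad : ∀ l, IsRadHom A (dP l))
    -- the degree `k = k' + 1 ≥ 1`
    (k' : ℕ)
    -- a chain map `g : P• → P•[k]`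
    (g : ∀ m, P (k' + m + 1) →ₗ[A] P m)
    (hchain : ∀ m, (g m) ∘ₗ (dP (k' + m + 1)) =
      ((-1 : ℤ) ^ (k' + 1)) • ((dP m) ∘ₗ (g (m + 1))))
    -- hypothesis: `g` is null-homotopic
    (hnull : ∃ h : ∀ m, P (k' + m) →ₗ[A] P m,
      ∀ m, g m = ((dP m) ∘ₗ (h (m + 1)) : P (k' + m + 1) →ₗ[A] P m) -
        ((-1 : ℤ) ^ k') • ((h m) ∘ₗ (dP (k' + m)))) :
    -- conclusion: `g = d(u)` for a homotopy `u` whose component `u^{(k-1)}` vanishes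
    ∃ h : ∀ m, P (k' + m) →ₗ[A] P m,
      h 0 = 0 ∧
      ∀ m, g m = ((dP m) ∘ₗ (h (m + 1)) : P (k' + m + 1) →ₗ[A] P m) -
        ((-1 : ℤ) ^ k') • ((h m) ∘ₗ (dP (k' + m))) := by
  obtain ⟨h, hg⟩ := hnull
  obtain ⟨m, js, hjs, ⟨E⟩⟩ := hPk k'
  have hvanish : π ∘ₗ (h 0 ∘ₗ dP k') = 0 :=
    comp_eq_zero_of_isRadHom e i hjs E ((hrad k').comp_left (h 0)) π
  obtain ⟨z, hz0, hz⟩ := exists_chain_map_extending P dP hex k' ((-1) ^ k') (h 0)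
    fun x => (hex0 _).1 (LinearMap.congr_fun hvanish x)
  refine ⟨fun m => h m - z m, sub_eq_zero.2 hz0.symm, fun m => ?_⟩
  rw [hg m]
  have e₁ : ((dP m) ∘ₗ (h (m + 1) - z (m + 1)) : P (k' + m + 1) →ₗ[A] P m) =
      ((dP m) ∘ₗ (h (m + 1)) : P (k' + m + 1) →ₗ[A] P m) -
        ((dP m) ∘ₗ (z (m + 1)) : P (k' + m + 1) →ₗ[A] P m) := LinearMap.comp_sub _ _ _
  rw [e₁, hz m, LinearMap.sub_comp, smul_sub]
  abel

end
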